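/- Every nonzero codeword of a projective 16-divisible binary linear code of effective length 131 has Hamming weight in the set {16, 32, 48, 64, 80}. -/

import Mathlib

/-- Hamming weight of a binary vector. -/
def hwt {n : ℕ} (c : Fin n → ZMod 2) : ℕ :=
  (Finset.univ.filter fun i => c i ≠ 0).card

/-- The sign character of `ZMod 2`. -/
def sgn2 (x : ZMod 2) : ℤ := if x = 0 then 1 else -1

lemma sgn2_add : ∀ x y : ZMod 2, sgn2 (x + y) = sgn2 x * sgn2 y := by decide

lemma sgn2_of_ne : ∀ x : ZMod 2, x ≠ 0 → sgn2 x = -1 := by decide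

lemma sgn2_sq : ∀ x : ZMod 2, sgn2 x * sgn2 x = 1 := by decide

lemma sum_sgn2 (c : Fin 131 → ZMod 2) : ∑ i, sgn2 (c i) = 131 - 2 * (hwt c : ℤ) := by
  have h : ∀ x : ZMod 2, sgn2 x = 1 - 2 * (if x ≠ 0 then 1 else 0) := by decide
  simp only [h, Finset.sum_sub_distrib, ← Finset.mul_sum, Finset.sum_boole, hwt]
  simp

lemma sum_char {G : Type*} [AddCommGroup G] [Fintype G] (f : G →+ ZMod 2) (g : G)
    (hg : f g ≠ 0) : ∑ d, sgn2 (f d) = 0 := by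
  have h := Equiv.sum_comp (Equiv.addRight g) (fun d => sgn2 (f d))
  simp only [Equiv.coe_addRight, map_add, sgn2_add, sgn2_of_ne _ hg, mul_neg, mul_one,
    Finset.sum_neg_distrib] at h
  omega

/-- Every nonzero codeword of a projective 16-divisible binary linear code of effective
length 131 has Hamming weight in `{16, 32, 48, 64, 80}`. -/
theorem weights_in_range (C : Submodule (ZMod 2) (Fin 131 → ZMod 2))
    (heff : ∀ i : Fin 131, ∃ c ∈ C, c i ≠ 0)
    (hproj : ∀ i j : Fin 131, i ≠ j → ∃ c ∈ C, c i ≠ c j)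
    (hdiv : ∀ c ∈ C, 16 ∣ hwt c) :
    ∀ c ∈ C, c ≠ 0 → hwt c ∈ ({16, 32, 48, 64, 80} : Set ℕ) := by
  classical
  intro c hc hc0
  obtain ⟨t, ht⟩ := hdiv c hc
  have hle : hwt c ≤ 131 := by
    unfold hwt; exact (Finset.card_le_univ _).trans (by simp)
  have hpos : hwt c ≠ 0 := by
    intro h
    apply hc0
    funext i
    by_contra hi
    have := Finset.card_eq_zero.mp h
    have hm : i ∈ Finset.univ.filter fun i => c i ≠ 0 := by simpa using hi
    rw [this] at hm
    simp at hm
  suffices h5 : t ≤ 5 by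
    have : t = 1 ∨ t = 2 ∨ t = 3 ∨ t = 4 ∨ t = 5 := by omega
    rw [ht]
    rcases this with rfl | rfl | rfl | rfl | rfl <;> simp
  by_contra h5
  set Z : Finset (Fin 131) := Finset.univ.filter fun i => c i = 0 with hZ
  set m : ℤ := (Z.card : ℤ) with hm
  have hs : ∀ d : Fin 131 → ZMod 2,
      2 * ∑ i ∈ Z, sgn2 (d i) = ∑ i, sgn2 (d i) + ∑ i, sgn2 ((c + d) i) := by
    intro d
    rw [hZ, Finset.sum_filter, Finset.mul_sum, ← Finset.sum_add_distrib]
    refine Finset.sum_congr rfl fun i _ => ?_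
    have : ∀ x y : ZMod 2, 2 * (if x = 0 then sgn2 y else 0) = sgn2 y + sgn2 (x + y) := by
      decide
    exact this _ _
  have hmt : m = 131 - 16 * t := by
    have h1 := hs 0
    rw [sum_sgn2, sum_sgn2] at h1
    simp [sgn2, hwt] at h1
    have h2 : ((hwt c : ℕ) : ℤ) = 16 * t := by rw [ht]; push_cast; ring
    simp only [hwt] at h2
    simp only [ne_eq] at h2
    rw [h2] at h1
    linarith
  have hC1 : ∀ i, ∑ d : C, sgn2 (d.1 i) = 0 := by
    intro i
    obtain ⟨e, he, hei⟩ := heff i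
    exact sum_char (((LinearMap.proj i : (Fin 131 → ZMod 2) →ₗ[ZMod 2] ZMod 2).comp
      C.subtype).toAddMonoidHom) ⟨e, he⟩ hei
  have hC2 : ∀ i j, i ≠ j → ∑ d : C, sgn2 (d.1 i) * sgn2 (d.1 j) = 0 := by
    intro i j hij
    obtain ⟨e, he, hei⟩ := hproj i j hij
    have h : ∀ x y : ZMod 2, x ≠ y → x + y ≠ 0 := by decide
    have := sum_char ((((LinearMap.proj i : (Fin 131 → ZMod 2) →ₗ[ZMod 2] ZMod 2) +
      LinearMap.proj j).comp C.subtype).toAddMonoidHom) ⟨e, he⟩ (h _ _ hei)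
    rw [← this]
    exact Finset.sum_congr rfl fun d _ => (sgn2_add _ _).symm
  have hS1 : ∑ d : C, ∑ i ∈ Z, sgn2 (d.1 i) = 0 := by
    rw [Finset.sum_comm]
    exact Finset.sum_eq_zero fun i _ => hC1 i
  have hS2 : ∑ d : C, (∑ i ∈ Z, sgn2 (d.1 i)) * (∑ i ∈ Z, sgn2 (d.1 i))
      = m * (Fintype.card C : ℤ) := by
    simp only [Finset.sum_mul_sum]
    rw [Finset.sum_comm]
    have : ∀ i ∈ Z, ∑ d : C, ∑ j ∈ Z, sgn2 (d.1 i) * sgn2 (d.1 j) = (Fintype.card C : ℤ) := by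
      intro i hi
      rw [Finset.sum_comm, Finset.sum_eq_single i]
      · simp only [sgn2_sq, Finset.sum_const, Finset.card_univ, nsmul_eq_mul, mul_one]
      · intro j _ hj
        exact hC2 i j hj.symm
      · intro h; exact absurd hi h
    rw [Finset.sum_congr rfl this]
    simp only [Finset.sum_const, nsmul_eq_mul, hm]
  have hN : (0 : ℤ) < Fintype.card C := by exact_mod_cast Fintype.card_pos
  have hnn : ∀ d : C, 0 ≤ (3 - ∑ i ∈ Z, sgn2 (d.1 i)) * (-13 - ∑ i ∈ Z, sgn2 (d.1 i)) := by
    intro d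
    have h1 := hs d.1
    rw [sum_sgn2, sum_sgn2] at h1
    obtain ⟨x, hx⟩ := hdiv _ d.2
    obtain ⟨y, hy⟩ := hdiv _ (C.add_mem hc d.2)
    rw [hx, hy] at h1
    generalize ∑ i ∈ Z, sgn2 (d.1 i) = s at *
    push_cast at h1
    rcases le_or_gt s (-13) with h | h
    · exact mul_nonneg (by linarith) (by linarith)
    · have : 3 ≤ s := by omega
      exact mul_nonneg_of_nonpos_of_nonpos (by linarith) (by linarith)
  have hsum := Finset.sum_nonneg fun d (_ : d ∈ (Finset.univ : Finset C)) => hnn d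
  have heq : ∑ d : C, (3 - ∑ i ∈ Z, sgn2 (d.1 i)) * (-13 - ∑ i ∈ Z, sgn2 (d.1 i))
      = (m - 39) * (Fintype.card C : ℤ) := by
    have : ∀ d : C, (3 - ∑ i ∈ Z, sgn2 (d.1 i)) * (-13 - ∑ i ∈ Z, sgn2 (d.1 i))
      = (∑ i ∈ Z, sgn2 (d.1 i)) * (∑ i ∈ Z, sgn2 (d.1 i)) + 10 * (∑ i ∈ Z, sgn2 (d.1 i))
        - 39 := fun d => by ring
    rw [Finset.sum_congr rfl fun d _ => this d, Finset.sum_sub_distrib, Finset.sum_add_distrib,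
      ← Finset.mul_sum, hS1, hS2]
    simp only [Finset.sum_const, Finset.card_univ, nsmul_eq_mul]
    ring
  rw [heq] at hsum
  have : m - 39 < 0 := by omega
  nlinarith
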